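/- For every k ≥ 2 and n ≥ 0, any two consecutive words of the list F_n^{(k)} have Hamming distance exactly 1, i.e., they differ in exactly one position. -/

import Mathlib

/-- Hamming distance between two words (of the same length): number of differing positions. -/
def hamming (a b : List ℕ) : ℕ :=
  ((a.zip b).filter (fun p => p.1 ≠ p.2)).length

/-- The generalized reflected Gray code list `G_{n,q}` over the alphabet `{1,…,q-1}`. -/
def G (q : ℕ) : ℕ → List (List ℕ)
  | 0 => [[]]
  | n + 1 =>
    (List.range (q - 1)).flatMap (fun j =>
      (if (j + 1) % 2 = 1 then G q n else (G q n).reverse).map (fun w => (j + 1) :: w))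

/-- Replace the 1's of a binary word (first arg), read from left to right,
by the letters of the second word. -/
def subst : List ℕ → List ℕ → List ℕ
  | [], _ => []
  | 0 :: β, w => 0 :: subst β w
  | _ :: β, w => w.headD 0 :: subst β w.tail

/-- The expansion `ε(β)` of a binary word `β` w.r.t. the alphabet `{0,…,q-1}`. -/
def expand (q : ℕ) (β : List ℕ) : List (List ℕ) :=
  (G q (β.count 1)).map (fun w => subst β w)

/-- The trace of a word: replace every nonzero letter by 1. -/
def trace (w : List ℕ) : List ℕ := w.map (fun x => if x = 0 then 0 else 1)

/-- The modified binary reflected Gray code list `C_n`. -/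
def C : ℕ → List (List ℕ)
  | 0 => [[]]
  | n + 1 => (C n).reverse.map (fun w => 1 :: w) ++ (C n).map (fun w => 0 :: w)

/-- The Gray code list `F_n^{(k)}` of length-`n` binary words avoiding `k` consecutive 0's. -/
def F (k n : ℕ) : List (List ℕ) :=
  if h : n < k then C n
  else (List.range k).attach.flatMap (fun ℓ =>
    ((F k (n - 1 - ℓ.1)).reverse).map (fun w => List.replicate ℓ.1 0 ++ 1 :: w))
termination_by n
decreasing_by
  have := List.mem_range.mp ℓ.2
  omega

/-- The list `H_{n,q}^{(k)}`. -/
def H (q k n : ℕ) : List (List ℕ) :=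
  ((F k (n - 2)).zipIdx.map Prod.swap).flatMap (fun p =>
    if p.1 % 2 = 0 then expand q (1 :: (p.2 ++ [1]))
    else (expand q (1 :: (p.2 ++ [1]))).reverse)

/-- The list `S_{n,q}^{(k)}`. -/
def S (q k n : ℕ) : List (List ℕ) :=
  (H q k (n - k)).map (fun w => List.replicate k 0 ++ w)

/-- The `k`-Fibonacci numbers. -/
def kfib (k n : ℕ) : ℕ :=
  if n < k then 2 ^ n
  else ∑ i ∈ (Finset.range k).attach, kfib k (n - 1 - i.1)
termination_by n
decreasing_by
  have := Finset.mem_range.mp i.2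
  omega

/-- The list `F_n^{(k)}(u)` (second recursive definition). -/
def Faux (k : ℕ) : ℕ → ℕ → List (List ℕ)
  | 0, _ => [[]]
  | n + 1, 0 => (Faux k n (k - 1)).reverse.map (fun w => 1 :: w)
  | n + 1, u + 1 =>
    (Faux k n (k - 1)).reverse.map (fun w => 1 :: w) ++ (Faux k n u).map (fun w => 0 :: w)


theorem hamming_cons_self (x : ℕ) (a b : List ℕ) : hamming (x :: a) (x :: b) = hamming a b := by
  simp [hamming]

theorem hamming_append_self (p a b : List ℕ) : hamming (p ++ a) (p ++ b) = hamming a b := by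
  induction p with
  | nil => rfl
  | cons x p ih => rw [List.cons_append, List.cons_append, hamming_cons_self, ih]

theorem hamming_self (a : List ℕ) : hamming a a = 0 := by
  induction a with
  | nil => rfl
  | cons x p ih => rw [hamming_cons_self, ih]

theorem hamming_one_zero (a : List ℕ) : hamming (1 :: a) (0 :: a) = 1 := by
  have := hamming_self a
  simp only [hamming] at this ⊢
  simpa using this

theorem hamming_comm' (a b : List ℕ) : hamming a b = hamming b a := by
  induction a generalizing b with
  | nil => cases b <;> rfl
  | cons x p ih =>
    cases b with
    | nil => rfl
    | cons y q =>
      have := ih q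
      simp only [hamming] at this ⊢
      by_cases h : x = y
      · subst h; simpa using this
      · have h' : ¬ y = x := fun e => h e.symm
        simpa [List.filter_cons, h, h'] using this

/-- The Gray-code property of a list of words. -/
def IsGray (L : List (List ℕ)) : Prop := L.IsChain (fun a b => hamming a b = 1)

theorem IsGray.rev {L : List (List ℕ)} (h : IsGray L) : IsGray L.reverse := by
  unfold IsGray at *
  rw [List.isChain_reverse]
  refine h.imp ?_
  intro a b hab
  rw [hamming_comm']
  exact hab

theorem IsGray.mapPre {L : List (List ℕ)} (h : IsGray L) (p : List ℕ) :
    IsGray (L.map (fun w => p ++ w)) := by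
  unfold IsGray at *
  rw [List.isChain_map]
  refine h.imp ?_
  intro a b hab
  rw [hamming_append_self]
  exact hab

theorem C_ne (n : ℕ) : C n ≠ [] := by
  induction n with
  | zero => simp [C]
  | succ n ih => simp [C, ih]

theorem C_gray (n : ℕ) : IsGray (C n) := by
  induction n with
  | zero => simp [C, IsGray]
  | succ n ih =>
    have h1 := ih.rev.mapPre [1]
    have h2 := ih.mapPre [0]
    unfold IsGray at *
    rw [C, List.isChain_append]
    refine ⟨h1, h2, ?_⟩
    intro x hx y hy
    simp only [List.getLast?_map, List.getLast?_reverse, List.head?_map, Option.mem_def,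
      Option.map_eq_some_iff] at hx hy
    obtain ⟨a, ha, rfl⟩ := hx
    obtain ⟨b, hb, rfl⟩ := hy
    rw [ha] at hb
    cases hb
    exact hamming_one_zero a

theorem F_lt {k n : ℕ} (h : n < k) : F k n = C n := by
  rw [F, dif_pos h]

theorem F_ge {k n : ℕ} (h : ¬ n < k) : F k n = (List.range k).flatMap (fun l =>
    ((F k (n - 1 - l)).reverse).map (fun w => List.replicate l 0 ++ 1 :: w)) := by
  rw [F, dif_neg h]
  simp

theorem F_ne {k : ℕ} (hk : 2 ≤ k) (n : ℕ) : F k n ≠ [] := by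
  induction n using Nat.strong_induction_on with
  | _ n ih =>
    by_cases h : n < k
    · rw [F_lt h]; exact C_ne n
    · rw [F_ge h]
      obtain ⟨j, rfl⟩ : ∃ j, k = j + 1 := ⟨k - 1, by omega⟩
      rw [List.range_succ_eq_map]
      have := ih (n - 1) (by omega)
      simp [this]

theorem F_head {k : ℕ} (hk : 2 ≤ k) (n : ℕ) :
    (F k (n + 1)).head? = (F k n).getLast?.map (fun w => 1 :: w) := by
  by_cases h : n + 1 < k
  · rw [F_lt h, F_lt (by omega : n < k), C, List.head?_append_of_ne_nil _ (by simp [C_ne])]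
    simp
  · rw [F_ge h]
    obtain ⟨j, rfl⟩ : ∃ j, k = j + 1 := ⟨k - 1, by omega⟩
    rw [List.range_succ_eq_map, List.flatMap_cons,
      List.head?_append_of_ne_nil _ (by simp [F_ne hk])]
    simp

theorem F_gray {k : ℕ} (hk : 2 ≤ k) (n : ℕ) : IsGray (F k n) := by
  induction n using Nat.strong_induction_on with
  | _ n ih =>
    by_cases h : n < k
    · rw [F_lt h]; exact C_gray n
    · rw [F_ge h]
      have key : ∀ j, j + 1 ≤ k → IsGray ((List.range (j + 1)).flatMap (fun l =>
          ((F k (n - 1 - l)).reverse).map (fun w => List.replicate l 0 ++ 1 :: w))) := by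
        have blk : ∀ l, l < k → IsGray (((F k (n - 1 - l)).reverse).map
            (fun w => List.replicate l 0 ++ 1 :: w)) := by
          intro l hl
          have := (ih (n - 1 - l) (by omega)).rev.mapPre (List.replicate l 0 ++ [1])
          simpa using this
        intro j
        induction j with
        | zero =>
          intro _
          simpa using blk 0 (by omega)
        | succ j ihj =>
          intro hj
          have h1 := ihj (by omega)
          have h2 := blk (j + 1) (by omega)
          unfold IsGray at *
          rw [List.range_succ, List.flatMap_append, List.isChain_append]
          refine ⟨h1, by simpa using h2, ?_⟩
          intro x hx y hy
          rw [List.range_succ, List.flatMap_append, List.flatMap_singleton,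
            List.getLast?_append_of_ne_nil _ (by simp [F_ne hk])] at hx
          rw [List.flatMap_singleton] at hy
          obtain ⟨m, hm⟩ : ∃ m, n - 1 - j = m + 1 := ⟨n - 1 - j - 1, by omega⟩
          have hm' : n - 1 - (j + 1) = m := by omega
          rw [hm] at hx
          rw [hm'] at hy
          simp only [List.getLast?_map, List.getLast?_reverse, List.head?_map, F_head hk,
            List.head?_reverse, Option.mem_def, Option.map_eq_some_iff] at hx hy
          obtain ⟨a, ⟨c, hc, rfl⟩, rfl⟩ := hx
          obtain ⟨b, hb, rfl⟩ := hy
          rw [hc] at hb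
          cases hb
          rw [List.replicate_succ', List.append_assoc, hamming_append_self]
          exact hamming_one_zero _
      obtain ⟨j, rfl⟩ : ∃ j, k = j + 1 := ⟨k - 1, by omega⟩
      exact key j le_rfl

/-- For every `k ≥ 2` and `n ≥ 0`, any two consecutive words of `F_n^{(k)}` differ in
exactly one position. -/
theorem stmt_12 (k n : ℕ) (hk : 2 ≤ k) (i : ℕ) (a b : List ℕ)
    (ha : (F k n)[i]? = some a) (hb : (F k n)[i + 1]? = some b) :
    hamming a b = 1 := by
  have h := F_gray hk n
  unfold IsGray at h
  rw [List.isChain_iff_getElem] at h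
  obtain ⟨h1, rfl⟩ := List.getElem?_eq_some_iff.mp ha
  obtain ⟨h2, rfl⟩ := List.getElem?_eq_some_iff.mp hb
  exact h i h2
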